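/- If the induced subdigraph D[V(P)] is a semicomplete digraph, then the induced subdigraph D[V(D)∖V(P)] is also a semicomplete digraph. -/

import Mathlib

variable {V : Type*}

/-- Two vertices are adjacent in the digraph with arc relation `A`. -/
def DAdj (A : V → V → Prop) (x y : V) : Prop := A x y ∨ A y x

/-- `x 0, x 1, …, x n` is a directed path of length `n` (distinct vertices, consecutive arcs). -/
def IsDipathOn (A : V → V → Prop) (n : ℕ) (x : ℕ → V) : Prop :=
  (∀ i j, i ≤ n → j ≤ n → x i = x j → i = j) ∧ ∀ i, i < n → A (x i) (x (i + 1))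

/-- There is a directed path of length `n` from `u` to `v`. -/
def HasDipath (A : V → V → Prop) (n : ℕ) (u v : V) : Prop :=
  ∃ x : ℕ → V, IsDipathOn A n x ∧ x 0 = u ∧ x n = v

/-- A digraph is `k`-quasi-transitive if the endpoints of every path of length `k` are adjacent. -/
def KQuasiTransitive (A : V → V → Prop) (k : ℕ) : Prop :=
  ∀ x : ℕ → V, IsDipathOn A k x → DAdj A (x 0) (x k)

/-- A digraph is strong if every vertex is reachable from every other vertex. -/
def StrongD (A : V → V → Prop) : Prop := ∀ u v : V, ∃ n, HasDipath A n u v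

/-- The subdigraph induced on `S` is semicomplete. -/
def SemicompleteOn (A : V → V → Prop) (S : Set V) : Prop :=
  ∀ x ∈ S, ∀ y ∈ S, x ≠ y → DAdj A x y

/-- The subdigraph induced on `S` is semicomplete bipartite. -/
def SemicompleteBipartiteOn (A : V → V → Prop) (S : Set V) : Prop :=
  ∃ X Y : Set V, X ∪ Y = S ∧ X ∩ Y = ∅ ∧
    (∀ x ∈ X, ∀ y ∈ X, ¬ DAdj A x y) ∧
    (∀ x ∈ Y, ∀ y ∈ Y, ¬ DAdj A x y) ∧
    (∀ x ∈ X, ∀ y ∈ Y, DAdj A x y)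

/-- The subdigraph induced on `S` has no arcs. -/
def EmptyOn (A : V → V → Prop) (S : Set V) : Prop :=
  ∀ x ∈ S, ∀ y ∈ S, ¬ A x y

/-- The vertex set `{P 0, …, P n}` of a path. -/
def VertsUpTo (n : ℕ) (P : ℕ → V) : Set V := {w | ∃ i ≤ n, P i = w}

/-- The odd-indexed vertices among `{P 0, …, P n}`. -/
def OddVertsUpTo (n : ℕ) (P : ℕ → V) : Set V := {w | ∃ i, i ≤ n ∧ Odd i ∧ P i = w}

/-- The even-indexed vertices among `{P 0, …, P n}`. -/
def EvenVertsUpTo (n : ℕ) (P : ℕ → V) : Set V := {w | ∃ i, i ≤ n ∧ Even i ∧ P i = w}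

/-- `I`: vertices outside `S` receiving no arc from `S`. -/
def ISet (A : V → V → Prop) (S : Set V) : Set V :=
  {x | x ∉ S ∧ ∀ w ∈ S, ¬ A w x}

/-- `W`: vertices outside `S` sending no arc to `S`. -/
def WSet (A : V → V → Prop) (S : Set V) : Set V :=
  {x | x ∉ S ∧ ∀ w ∈ S, ¬ A x w}

/-- `B`: vertices outside `S` that are in neither `I` nor `W`. -/
def BSet (A : V → V → Prop) (S : Set V) : Set V :=
  {x | x ∉ S ∧ x ∉ ISet A S ∧ x ∉ WSet A S}

/-- There is a directed path of length `n` from `u` to `v` all of whose vertices lie in `T`. -/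
def PathIn (A : V → V → Prop) (T : Set V) (n : ℕ) (u v : V) : Prop :=
  ∃ f : ℕ → V, IsDipathOn A n f ∧ f 0 = u ∧ f n = v ∧ ∀ i ≤ n, f i ∈ T

theorem PathIn.mono {A : V → V → Prop} {T T' : Set V} {n : ℕ} {u v : V}
    (h : PathIn A T n u v) (hT : T ⊆ T') : PathIn A T' n u v := by
  obtain ⟨f, hf, h0, hn, hm⟩ := h
  exact ⟨f, hf, h0, hn, fun i hi => hT (hm i hi)⟩

theorem PathIn.single (A : V → V → Prop) (u : V) : PathIn A {u} 0 u u :=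
  ⟨fun _ => u, ⟨fun i j hi hj _ => by omega, fun i hi => by omega⟩, rfl, rfl, fun _ _ => rfl⟩

theorem PathIn.append {A : V → V → Prop} {T T' : Set V} {n m : ℕ} {u v w z : V}
    (h : PathIn A T n u v) (hvw : A v w) (h' : PathIn A T' m w z) (hd : Disjoint T T') :
    PathIn A (T ∪ T') (n + 1 + m) u z := by
  obtain ⟨f, ⟨hfi, hfs⟩, hf0, hfn, hfm⟩ := h
  obtain ⟨g, ⟨hgi, hgs⟩, hg0, hgn, hgm⟩ := h'
  have hne : ∀ i j, i ≤ n → j ≤ m → f i ≠ g j := fun i j hi hj h =>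
    Set.disjoint_left.1 hd (hfm i hi) (h ▸ hgm j hj)
  refine ⟨fun t => if t ≤ n then f t else g (t - (n + 1)), ⟨?_, ?_⟩, ?_, ?_, ?_⟩
  · intro i j hi hj hij
    dsimp only at hij
    split_ifs at hij with h1 h2 h2
    · exact hfi i j h1 h2 hij
    · exact absurd hij (hne _ _ h1 (by omega))
    · exact absurd hij.symm (hne _ _ h2 (by omega))
    · have := hgi _ _ (by omega) (by omega) hij
      omega
  · intro i hi
    dsimp only
    split_ifs with h1 h2 h2
    · exact hfs i (by omega)
    · obtain rfl : i = n := by omega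
      simpa [hfn, hg0] using hvw
    · omega
    · have := hgs (i - (n + 1)) (by omega)
      rwa [show i - (n + 1) + 1 = i + 1 - (n + 1) by omega] at this
  · simpa using hf0
  · simpa [show ¬ n + 1 + m ≤ n by omega] using hgn
  · intro i hi
    dsimp only
    split_ifs with h1
    · exact Or.inl (hfm i h1)
    · exact Or.inr (hgm _ (by omega))

theorem PathIn.cons {A : V → V → Prop} {T : Set V} {m : ℕ} {u w z : V}
    (huw : A u w) (h : PathIn A T m w z) (hu : u ∉ T) : PathIn A ({u} ∪ T) (m + 1) u z := by
  have := (PathIn.single A u).append huw h (by simpa using hu)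
  rwa [show 0 + 1 + m = m + 1 by omega] at this

theorem PathIn.concat {A : V → V → Prop} {T : Set V} {n : ℕ} {u v w : V}
    (h : PathIn A T n u v) (hvw : A v w) (hw : w ∉ T) : PathIn A (T ∪ {w}) (n + 1) u w :=
  h.append hvw (PathIn.single A w) (by simpa using hw)

theorem KQuasiTransitive.dadj {A : V → V → Prop} {k n : ℕ} (h : KQuasiTransitive A k)
    {T : Set V} {u v : V} (hp : PathIn A T n u v) (hn : n = k) : DAdj A u v := by
  subst hn
  obtain ⟨f, hf, rfl, rfl, -⟩ := hp
  exact h f hf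

theorem IsDipathOn.reverse {A : V → V → Prop} {n : ℕ} {x : ℕ → V} (h : IsDipathOn A n x) :
    IsDipathOn (fun a b => A b a) n (fun i => x (n - i)) := by
  refine ⟨fun i j hi hj hij => ?_, fun i hi => ?_⟩
  · have := h.1 _ _ (by omega) (by omega) hij
    omega
  · have := h.2 (n - (i + 1)) (by omega)
    rwa [show n - (i + 1) + 1 = n - i by omega] at this

theorem KQuasiTransitive.reverse {A : V → V → Prop} {k : ℕ} (h : KQuasiTransitive A k) :
    KQuasiTransitive (fun a b => A b a) k := by
  intro x hx
  simpa [DAdj] using h _ hx.reverse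

/-- A path `x 0, …, x (k + 2)` in a strong `k`-quasi-transitive digraph such that all arcs
`x j → x i` with `i + 2 ≤ j` are present and no outside vertex provides a shortcut. -/
structure BackwardPath (A : V → V → Prop) (k : ℕ) (x : ℕ → V) : Prop where
  five_le : 5 ≤ k
  quasi : KQuasiTransitive A k
  strong : ∀ a b, Relation.ReflTransGen A a b
  path : IsDipathOn A (k + 2) x
  back : ∀ i j, i + 2 ≤ j → j ≤ k + 2 → A (x j) (x i)
  shortcut : ∀ i j w, i ≤ k + 2 → j ≤ k + 2 → w ∉ VertsUpTo (k + 2) x →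
    A (x i) w → A w (x j) → j ≤ i + 2

theorem VertsUpTo_reverse (n : ℕ) (x : ℕ → V) :
    VertsUpTo n (fun i => x (n - i)) = VertsUpTo n x := by
  ext w
  constructor
  · rintro ⟨i, -, rfl⟩
    exact ⟨n - i, by omega, rfl⟩
  · rintro ⟨i, hi, rfl⟩
    exact ⟨n - i, by omega, by simp [Nat.sub_sub_self hi]⟩

namespace BackwardPath

variable {A : V → V → Prop} {k : ℕ} {x : ℕ → V}

theorem reverse (h : BackwardPath A k x) :
    BackwardPath (fun a b => A b a) k (fun i => x (k + 2 - i)) where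
  five_le := h.five_le
  quasi := h.quasi.reverse
  strong a b := (h.strong b a).swap
  path := h.path.reverse
  back i j hij hj := h.back _ _ (by omega) (by omega)
  shortcut i j w hi hj hw h1 h2 := by
    rw [VertsUpTo_reverse] at hw
    have := h.shortcut _ _ w (by omega) (by omega) hw h2 h1
    omega

/-- An index sequence with steps `+1` or at most `-2` gives a path inside the vertex set. -/
theorem pathIn_of_index (h : BackwardPath A k x) {L : ℕ} (f : ℕ → ℕ)
    (hle : ∀ t ≤ L, f t ≤ k + 2) (hinj : ∀ s t, s ≤ L → t ≤ L → f s = f t → s = t)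
    (hstep : ∀ t < L, f (t + 1) = f t + 1 ∨ f (t + 1) + 2 ≤ f t) :
    PathIn A (VertsUpTo (k + 2) x) L (x (f 0)) (x (f L)) := by
  refine ⟨fun t => x (f t), ⟨fun s t hs ht hst => ?_, fun t ht => ?_⟩, rfl, rfl,
    fun t ht => ⟨f t, hle t ht, rfl⟩⟩
  · exact hinj s t hs ht (h.path.1 _ _ (hle s hs) (hle t ht) hst)
  · rcases hstep t ht with h1 | h1
    · have := hle (t + 1) ht
      simpa [h1] using h.path.2 (f t) (by omega)
    · exact h.back _ _ h1 (hle t ht.le)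

theorem pathIn_up (h : BackwardPath A k x) {i j : ℕ} (hij : i ≤ j) (hj : j ≤ k + 2) :
    PathIn A (VertsUpTo (k + 2) x) (j - i) (x i) (x j) := by
  have := h.pathIn_of_index (L := j - i) (fun t => i + t) (fun t ht => by omega)
    (fun s t _ _ hst => by omega) (fun t _ => by omega)
  simpa [Nat.add_sub_cancel' hij] using this

/-- The vertices lie on a cycle of length `k + 3`, so paths of every length start anywhere. -/
theorem pathIn_from (h : BackwardPath A k x) {a : V} (ha : a ∈ VertsUpTo (k + 2) x) {L : ℕ}
    (hL : L ≤ k) : ∃ b ∈ VertsUpTo (k + 2) x, PathIn A (VertsUpTo (k + 2) x) L a b := by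
  obtain ⟨i, hi, rfl⟩ := ha
  have := h.pathIn_of_index (L := L) (fun t => if i + t ≤ k + 2 then i + t else i + t - (k + 3))
    (fun t ht => by split_ifs <;> omega)
    (fun s t _ _ hst => by split_ifs at hst <;> omega)
    (fun t _ => by split_ifs <;> omega)
  refine ⟨_, ⟨_, ?_, rfl⟩, by simpa [hi] using this⟩
  split_ifs <;> omega

theorem pathIn_to (h : BackwardPath A k x) {b : V} (hb : b ∈ VertsUpTo (k + 2) x) {L : ℕ}
    (hL : L ≤ k) : ∃ a ∈ VertsUpTo (k + 2) x, PathIn A (VertsUpTo (k + 2) x) L a b := by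
  obtain ⟨a, ha, f, hf, h0, hl, hm⟩ := h.reverse.pathIn_from
    (by rwa [VertsUpTo_reverse] : b ∈ VertsUpTo (k + 2) fun i => x (k + 2 - i)) hL
  rw [VertsUpTo_reverse] at ha hm
  exact ⟨a, ha, fun i => f (L - i), hf.reverse, by simpa using hl, by simpa using h0,
    fun i _ => hm _ (by omega)⟩

theorem pathIn_down (h : BackwardPath A k x) {i j L : ℕ} (hij : i < j) (hj : j ≤ k + 2)
    (hL : L + 1 = k ∨ L + 2 = k) : PathIn A (VertsUpTo (k + 2) x) L (x j) (x i) := by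
  have h5 := h.five_le
  by_cases hgap : j - i + L ≤ k + 3
  · obtain ⟨a, b, hai, hjb, hbn, hab⟩ : ∃ a b, a ≤ i ∧ j ≤ b ∧ b ≤ k + 2 ∧
        b + i + 1 = L + j + a := by
      by_cases hi : L ≤ i + 1
      · exact ⟨i + 1 - L, j, by omega, by omega, by omega, by omega⟩
      exact ⟨0, L + j - i - 1, by omega, by omega, by omega, by omega⟩
    have := h.pathIn_of_index (L := L) (fun t => if j + t ≤ b then j + t else a + (j + t - (b + 1)))
      (fun t ht => by split_ifs <;> omega)
      (fun s t _ _ hst => by split_ifs at hst <;> omega)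
      (fun t _ => by split_ifs <;> omega)
    convert this using 2
    · split_ifs <;> omega
    · split_ifs <;> omega
  · -- climb to the top, run through a middle segment, and climb from the bottom
    have := h.pathIn_of_index (L := L) (fun t => if j + t ≤ k + 2 then j + t else
        if t + i < L then i + 3 + (j + t - (k + 3)) else t + i - L)
      (fun t ht => by split_ifs <;> omega)
      (fun s t _ _ hst => by split_ifs at hst <;> omega)
      (fun t _ => by split_ifs <;> omega)
    convert this using 2
    · split_ifs <;> omega
    · split_ifs <;> omega

theorem dadj_above (h : BackwardPath A k x) {w : V} (hw : w ∉ VertsUpTo (k + 2) x) {i j : ℕ}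
    (hij : i < j) (hj : j ≤ k + 2) (hi : A (x i) w) : DAdj A (x j) w := by
  have h5 := h.five_le
  exact h.quasi.dadj ((h.pathIn_down (L := k - 1) hij hj (by omega)).concat hi hw) (by omega)

theorem dadj_below (h : BackwardPath A k x) {w : V} (hw : w ∉ VertsUpTo (k + 2) x) {i j : ℕ}
    (hij : i < j) (hj : j ≤ k + 2) (hi : A w (x j)) : DAdj A (x i) w := by
  have h5 := h.five_le
  exact (h.quasi.dadj ((h.pathIn_down (L := k - 1) hij hj (by omega)).cons hi hw)
    (by omega)).symm

theorem dadj_sub (h : BackwardPath A k x) {w : V} (hw : w ∉ VertsUpTo (k + 2) x) {i j : ℕ}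
    (hij : i + k = j + 1) (hj : j ≤ k + 2) (hi : A (x j) w) : DAdj A (x i) w := by
  have h5 := h.five_le
  exact h.quasi.dadj ((h.pathIn_up (show i ≤ j by omega) hj).concat hi hw) (by omega)

theorem dadj_add (h : BackwardPath A k x) {w : V} (hw : w ∉ VertsUpTo (k + 2) x) {i j : ℕ}
    (hij : i + k = j + 1) (hj : j ≤ k + 2) (hi : A w (x i)) : DAdj A (x j) w := by
  have h5 := h.five_le
  exact (h.quasi.dadj ((h.pathIn_up (show i ≤ j by omega) hj).cons hi hw) (by omega)).symm

/-- An outside vertex sending no arc to the path but receiving one is dominated by the path. -/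
theorem dominated (h : BackwardPath A k x) {w : V} (hw : w ∉ VertsUpTo (k + 2) x)
    (hout : ∀ a ∈ VertsUpTo (k + 2) x, ¬ A w a) {a : V} (ha : a ∈ VertsUpTo (k + 2) x)
    (haw : A a w) : ∀ b ∈ VertsUpTo (k + 2) x, A b w := by
  have h5 := h.five_le
  have key : ∀ j ≤ k + 2, DAdj A (x j) w → A (x j) w := fun j hj hadj =>
    hadj.resolve_right (hout _ ⟨j, hj, rfl⟩)
  have above : ∀ i j, i ≤ j → j ≤ k + 2 → A (x i) w → A (x j) w := by
    intro i j hij hj hi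
    rcases hij.eq_or_lt with rfl | hlt
    · exact hi
    · exact key j hj (h.dadj_above hw hlt hj hi)
  obtain ⟨i, hi, rfl⟩ := ha
  have htop := above i (k + 2) hi le_rfl haw
  have hthree := key 3 (by omega) (h.dadj_sub hw (by omega) le_rfl htop)
  have hlate := above 3 (k - 1) (by omega) (by omega) hthree
  have hzero := key 0 (by omega) (h.dadj_sub hw (by omega) (by omega) hlate)
  rintro _ ⟨j, hj, rfl⟩
  exact above 0 j (by omega) hj hzero

/-- No path of length `k - 2` along `x` joins an out-neighbour of `y` to an in-neighbour of `z`
when `y` and `z` are nonadjacent outside vertices. -/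
theorem index_constraint (h : BackwardPath A k x) {y z : V} (hy : y ∉ VertsUpTo (k + 2) x)
    (hz : z ∉ VertsUpTo (k + 2) x) (hyz : y ≠ z) (hna : ¬ DAdj A y z) {i j : ℕ}
    (hi : i ≤ k + 2) (hj : j ≤ k + 2) (hyj : A y (x j)) (hiz : A (x i) z) :
    j ≤ i ∧ i + 2 ≠ j + k := by
  have h5 := h.five_le
  refine ⟨le_of_not_gt fun hij => hna ?_, fun hij => hna ?_⟩
  · exact h.quasi.dadj (((h.pathIn_down (L := k - 2) hij hj (by omega)).cons hyj hy).concat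
      hiz (by simp [hz, hyz.symm])) (by omega)
  · exact h.quasi.dadj (((h.pathIn_up (show j ≤ i by omega) hi).cons hyj hy).concat
      hiz (by simp [hz, hyz.symm])) (by omega)

theorem exists_early_in (h : BackwardPath A k x) {y z : V} (hy : y ∉ VertsUpTo (k + 2) x)
    (hz : z ∉ VertsUpTo (k + 2) x) (hyz : y ≠ z) (hna : ¬ DAdj A y z)
    (hyout : ∃ a ∈ VertsUpTo (k + 2) x, A y a) (hzin : ∃ a ∈ VertsUpTo (k + 2) x, A a z) :
    ∃ i, i + 1 ≤ k ∧ A (x i) y := by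
  have h5 := h.five_le
  by_contra! hlate
  obtain ⟨_, ⟨j, hj, rfl⟩, hyj⟩ := hyout
  obtain ⟨_, ⟨i, hi, rfl⟩, hiz⟩ := hzin
  have below : ∀ s t, s ≤ t → t ≤ k + 2 → s + 1 ≤ k → A y (x t) → A y (x s) := by
    intro s t hst ht hs hyt
    rcases hst.eq_or_lt with rfl | hlt
    · exact hyt
    · exact (h.dadj_below hy hlt ht hyt).resolve_left (hlate s hs)
  have hzero := below 0 j (by omega) hj (by omega) hyj
  have hnear := (h.dadj_add hy (show 0 + k = k - 1 + 1 by omega) (by omega) hzero).resolve_left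
    (hlate _ (by omega))
  have hki := (h.index_constraint hy hz hyz hna hi (by omega) hnear hiz).1
  exact (h.index_constraint (j := i + 2 - k) hy hz hyz hna hi (by omega)
    (below _ (k - 1) (by omega) (by omega) (by omega) hnear) hiz).2 (by omega)

theorem exists_late_out (h : BackwardPath A k x) {y z : V} (hy : y ∉ VertsUpTo (k + 2) x)
    (hz : z ∉ VertsUpTo (k + 2) x) (hyz : y ≠ z) (hna : ¬ DAdj A y z)
    (hyin : ∃ a ∈ VertsUpTo (k + 2) x, A a y) (hzout : ∃ a ∈ VertsUpTo (k + 2) x, A z a) :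
    ∃ j, 3 ≤ j ∧ j ≤ k + 2 ∧ A y (x j) := by
  have hrev := h.reverse.exists_early_in (y := y) (z := z)
  rw [VertsUpTo_reverse] at hrev
  obtain ⟨i, hi, hyi⟩ := hrev hy hz hyz (fun h' => hna h'.symm) hyin hzout
  exact ⟨k + 2 - i, by omega, by omega, hyi⟩

theorem not_out_three (h : BackwardPath A k x) {y z : V} (hy : y ∉ VertsUpTo (k + 2) x)
    (hz : z ∉ VertsUpTo (k + 2) x) (hyz : y ≠ z) (hna : ¬ DAdj A y z) {i j : ℕ}
    (hi : i + 1 ≤ k) (hiy : A (x i) y) (hj : j + 1 ≤ k) (hjz : A (x j) z) : ¬ A y (x 3) := by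
  intro hthree
  rcases h.dadj_above hz (show j < k + 1 by omega) (by omega) hjz with hin | hout
  · exact (h.index_constraint hy hz hyz hna (by omega) (by omega) hthree hin).2 (by omega)
  · have := (h.index_constraint hz hy hyz.symm (fun h' => hna h'.symm) (by omega) (by omega)
      hout hiy).1
    omega

theorem in_three (h : BackwardPath A k x) {y : V} (hy : y ∉ VertsUpTo (k + 2) x) {i : ℕ}
    (hi : i + 1 ≤ k) (hiy : A (x i) y) (hthree : ¬ A y (x 3)) : A (x 3) y := by
  have h5 := h.five_le
  have htop : A (x (k + 2)) y := by
    refine (h.dadj_above hy (show i < k + 2 by omega) le_rfl hiy).resolve_right fun hout => ?_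
    have := h.shortcut i (k + 2) y (by omega) le_rfl hy hiy hout
    omega
  exact (h.dadj_sub hy (by omega) le_rfl htop).resolve_right hthree

/-- Two outside vertices each having arcs both to and from the path are adjacent. -/
theorem dadj_of_both (h : BackwardPath A k x) {y z : V} (hy : y ∉ VertsUpTo (k + 2) x)
    (hz : z ∉ VertsUpTo (k + 2) x) (hyz : y ≠ z)
    (hyout : ∃ a ∈ VertsUpTo (k + 2) x, A y a) (hyin : ∃ a ∈ VertsUpTo (k + 2) x, A a y)
    (hzout : ∃ a ∈ VertsUpTo (k + 2) x, A z a) (hzin : ∃ a ∈ VertsUpTo (k + 2) x, A a z) :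
    DAdj A y z := by
  have h5 := h.five_le
  by_contra hna
  have hna' : ¬ DAdj A z y := fun h' => hna h'.symm
  obtain ⟨i, hi, hiy⟩ := h.exists_early_in hy hz hyz hna hyout hzin
  obtain ⟨j, hj, hjz⟩ := h.exists_early_in hz hy hyz.symm hna' hzout hyin
  obtain ⟨m, hm, hmk, hzm⟩ := h.exists_late_out hz hy hyz.symm hna' hzin hyout
  have hy3 := h.in_three hy hi hiy (h.not_out_three hy hz hyz hna hi hiy hj hjz)
  have hz3 := h.in_three hz hj hjz (h.not_out_three hz hy hyz.symm hna' hj hjz hi hiy)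
  have hzero : A z (x 0) := by
    refine (h.dadj_below hz (show 0 < m by omega) hmk hzm).resolve_left fun hin => ?_
    have := h.shortcut 0 m z (by omega) hmk hz hin hzm
    omega
  have hnin : ¬ A (x (k - 2)) y := fun hin =>
    (h.index_constraint hz hy hyz.symm hna' (by omega) (by omega) hzero hin).2 (by omega)
  rcases h5.eq_or_lt with rfl | hlt
  · exact hnin hy3
  · have hout := (h.dadj_above hy (show 3 < k - 2 by omega) (by omega) hy3).resolve_left hnin
    have := (h.index_constraint hy hz hyz hna (by omega) (by omega) hout hz3).1
    omega

end BackwardPath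

/-- `δ` is the distance to the set `S` in the digraph `A`. -/
structure IsDistTo (A : V → V → Prop) (S : Set V) (δ : V → ℕ) : Prop where
  eq_zero_iff : ∀ y, δ y = 0 ↔ y ∈ S
  le_succ : ∀ y z, A y z → δ y ≤ δ z + 1
  exists_succ : ∀ y, δ y ≠ 0 → ∃ z, A y z ∧ δ z + 1 = δ y

/-- There is a directed walk of length `m` from the given vertex to the set `S`. -/
def ReachesIn (A : V → V → Prop) (S : Set V) : ℕ → V → Prop
  | 0, y => y ∈ S
  | m + 1, y => ∃ z, A y z ∧ ReachesIn A S m z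

theorem exists_isDistTo {A : V → V → Prop} {S : Set V}
    (hS : ∀ y, ∃ s ∈ S, Relation.ReflTransGen A y s) : ∃ δ, IsDistTo A S δ := by
  classical
  have hR : ∀ y, ∃ m, ReachesIn A S m y := by
    intro y
    obtain ⟨s, hs, hys⟩ := hS y
    induction hys using Relation.ReflTransGen.head_induction_on with
    | refl => exact ⟨0, hs⟩
    | head hab _ ih =>
      obtain ⟨m, hm⟩ := ih
      exact ⟨m + 1, _, hab, hm⟩
  have hle : ∀ y z : V, A y z → Nat.find (hR y) ≤ Nat.find (hR z) + 1 := by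
    intro y z hyz
    exact Nat.find_min' (hR y) ⟨z, hyz, Nat.find_spec (hR z)⟩
  refine ⟨fun y => Nat.find (hR y), fun y => Nat.find_eq_zero (hR y), hle, fun y hy => ?_⟩
  obtain ⟨m, hm⟩ := Nat.exists_eq_succ_of_ne_zero hy
  have hspec := Nat.find_spec (hR y)
  rw [hm] at hspec
  obtain ⟨z, hyz, hz⟩ := hspec
  refine ⟨z, hyz, ?_⟩
  have h1 := Nat.find_min' (hR z) hz
  have h2 := hle y z hyz
  omega

theorem IsDistTo.exists_pathIn {A : V → V → Prop} {S : Set V} {δ : V → ℕ} (h : IsDistTo A S δ)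
    (t : ℕ) (y : V) (ht : t ≤ δ y) : ∃ z, δ z + t = δ y ∧
      PathIn A {w | w = y ∨ (δ w < δ y ∧ δ y ≤ δ w + t)} t y z := by
  induction t generalizing y with
  | zero => exact ⟨y, rfl, (PathIn.single A y).mono (by rintro _ rfl; exact Or.inl rfl)⟩
  | succ t ih =>
    obtain ⟨w, hyw, hw⟩ := h.exists_succ y (by omega)
    obtain ⟨z, hz, hp⟩ := ih w (by omega)
    refine ⟨z, by omega, (hp.cons hyw ?_).mono ?_⟩
    · rintro (rfl | ⟨h1, -⟩) <;> omega
    · rintro v (rfl | rfl | ⟨h1, h2⟩)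
      · exact Or.inl rfl
      · exact Or.inr ⟨by omega, by omega⟩
      · exact Or.inr ⟨by omega, by omega⟩

namespace BackwardPath

variable {A : V → V → Prop} {k : ℕ} {x : ℕ → V} {δ : V → ℕ}

/-- Vertices at distance at least two from the path are dominated by it. -/
theorem dominated_of_two_le (h : BackwardPath A k x) (hδ : IsDistTo A (VertsUpTo (k + 2) x) δ)
    (y : V) (hy : 2 ≤ δ y) : ∀ b ∈ VertsUpTo (k + 2) x, A b y := by
  have h5 := h.five_le
  induction hm : δ y using Nat.strong_induction_on generalizing y with
  | _ m ih =>
  have notin : ∀ w, δ w ≠ 0 → w ∉ VertsUpTo (k + 2) x := fun w hw hmem =>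
    hw ((hδ.eq_zero_iff w).2 hmem)
  have noout : ∀ w, 2 ≤ δ w → ∀ a ∈ VertsUpTo (k + 2) x, ¬ A w a := by
    intro w hw a ha hwa
    have := hδ.le_succ w a hwa
    have := (hδ.eq_zero_iff a).2 ha
    omega
  suffices hadj : ∃ a ∈ VertsUpTo (k + 2) x, DAdj A a y by
    obtain ⟨a, ha, hay⟩ := hadj
    exact h.dominated (notin y (by omega)) (noout y hy) ha (hay.resolve_right (noout y hy a ha))
  by_cases hmk : m ≤ k
  · obtain ⟨w, hw, hp⟩ := hδ.exists_pathIn (m - 1) y (by omega)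
    obtain ⟨s, hws, hs⟩ := hδ.exists_succ w (by omega)
    have hsS := (hδ.eq_zero_iff s).1 (by omega)
    obtain ⟨b, hb, hq⟩ := h.pathIn_from hsS (show k - m ≤ k by omega)
    refine ⟨b, hb, (h.quasi.dadj (hp.append hws hq ?_) (by omega)).symm⟩
    refine Set.disjoint_left.2 ?_
    rintro v (rfl | ⟨h1, h2⟩)
    · exact notin _ (by omega)
    · exact notin _ (by omega)
  · obtain ⟨w, hw, hp⟩ := hδ.exists_pathIn (k - 1) y (by omega)
    obtain ⟨z, hwz, hz⟩ := hδ.exists_succ w (by omega)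
    have hzy : A z y := by
      refine (h.quasi.dadj (hp.concat hwz ?_) (by omega)).resolve_left fun hyz => ?_
      · rintro (rfl | ⟨h1, h2⟩) <;> omega
      · have := hδ.le_succ y z hyz
        omega
    have ne_of_lt : ∀ a b, δ a < δ b → b ≠ a := by
      rintro a _ hab rfl
      omega
    have h0 : x 0 ∈ VertsUpTo (k + 2) x := ⟨0, by omega, rfl⟩
    obtain ⟨a, ha, hq⟩ := h.pathIn_to h0 (show k - 3 ≤ k by omega)
    have hwdom := ih _ (by omega) w (by omega) rfl _ h0
    refine ⟨a, ha, h.quasi.dadj (((hq.concat hwdom (notin w (by omega))).concat hwz ?_).concat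
      hzy ?_) (by omega)⟩
    · simp [notin z (by omega), (ne_of_lt z w (by omega)).symm]
    · simp [notin y (by omega), ne_of_lt z y (by omega), ne_of_lt w y (by omega)]

/-- A vertex at distance at least two from the path is adjacent to every outside vertex that is
not farther away. -/
theorem dadj_of_two_le (h : BackwardPath A k x) (hδ : IsDistTo A (VertsUpTo (k + 2) x) δ)
    {w : V} (hw : 2 ≤ δ w) (y : V) (hy : δ y ≠ 0) (hyw : y ≠ w) (hle : δ y ≤ δ w) :
    DAdj A y w := by
  have h5 := h.five_le
  have hdom := h.dominated_of_two_le hδ w hw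
  induction hm : δ y using Nat.strong_induction_on generalizing y with
  | _ m ih =>
  have notin : ∀ w, δ w ≠ 0 → w ∉ VertsUpTo (k + 2) x := fun w hw hmem =>
    hw ((hδ.eq_zero_iff w).2 hmem)
  by_cases hmk : m + 1 ≤ k
  · obtain ⟨z, hz, hp⟩ := hδ.exists_pathIn (m - 1) y (by omega)
    obtain ⟨s, hzs, hs⟩ := hδ.exists_succ z (by omega)
    have hsS := (hδ.eq_zero_iff s).1 (by omega)
    obtain ⟨b, hb, hq⟩ := h.pathIn_from hsS (show k - 1 - m ≤ k by omega)
    refine h.quasi.dadj ((hp.append hzs hq ?_).concat (hdom b hb) ?_) (by omega)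
    · refine Set.disjoint_left.2 ?_
      rintro v (rfl | ⟨h1, h2⟩)
      · exact notin _ (by omega)
      · exact notin _ (by omega)
    · rintro ((rfl | ⟨h1, h2⟩) | hwS)
      · exact hyw rfl
      · omega
      · exact notin w (by omega) hwS
  · obtain ⟨z, hz, hp⟩ := hδ.exists_pathIn (k - 1) y (by omega)
    have hzw : A z w := by
      refine (ih _ (by omega) z (by omega) ?_ (by omega) rfl).resolve_right fun hwz => ?_
      · rintro rfl
        omega
      · have := hδ.le_succ w z hwz
        omega
    refine h.quasi.dadj (hp.concat hzw ?_) (by omega)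
    rintro (rfl | ⟨h1, h2⟩)
    · exact hyw rfl
    · omega

theorem dadj_of_no_out (h : BackwardPath A k x) {y z : V} (hy : y ∉ VertsUpTo (k + 2) x)
    (hz : z ∉ VertsUpTo (k + 2) x) (hyz : y ≠ z)
    (hno : ¬ ((∃ a ∈ VertsUpTo (k + 2) x, A y a) ∧ ∃ a ∈ VertsUpTo (k + 2) x, A z a)) :
    DAdj A y z := by
  obtain ⟨δ, hδ⟩ := exists_isDistTo (A := A) (S := VertsUpTo (k + 2) x)
    fun y => ⟨x 0, ⟨0, by omega, rfl⟩, h.strong _ _⟩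
  have pos : ∀ w, w ∉ VertsUpTo (k + 2) x → δ w ≠ 0 := fun w hw h0 =>
    hw ((hδ.eq_zero_iff w).1 h0)
  have out : ∀ w, δ w = 1 → ∃ a ∈ VertsUpTo (k + 2) x, A w a := by
    intro w hw
    obtain ⟨a, hwa, ha⟩ := hδ.exists_succ w (by omega)
    exact ⟨a, (hδ.eq_zero_iff a).1 (by omega), hwa⟩
  have hy0 := pos y hy
  have hz0 := pos z hz
  have hfar : 2 ≤ δ y ∨ 2 ≤ δ z := by
    by_contra! hnear
    exact hno ⟨out y (by omega), out z (by omega)⟩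
  rcases le_total (δ y) (δ z) with hle | hle
  · exact h.dadj_of_two_le hδ (by omega) y hy0 hyz hle
  · exact (h.dadj_of_two_le hδ (by omega) z hz0 hyz.symm hle).symm

theorem semicompleteOn_compl (h : BackwardPath A k x) :
    SemicompleteOn A {w | w ∉ VertsUpTo (k + 2) x} := by
  intro y hy z hz hyz
  by_cases hout : (∃ a ∈ VertsUpTo (k + 2) x, A y a) ∧ ∃ a ∈ VertsUpTo (k + 2) x, A z a
  · by_cases hin : (∃ a ∈ VertsUpTo (k + 2) x, A a y) ∧ ∃ a ∈ VertsUpTo (k + 2) x, A a z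
    · exact h.dadj_of_both hy hz hyz hout.1 hin.1 hout.2 hin.2
    · have hrev := h.reverse.dadj_of_no_out (y := y) (z := z)
      rw [VertsUpTo_reverse] at hrev
      exact (hrev hy hz hyz hin).symm
  · exact h.dadj_of_no_out hy hz hyz hout

end BackwardPath

theorem HasDipath.reflTransGen {A : V → V → Prop} {n : ℕ} {u v : V} (h : HasDipath A n u v) :
    Relation.ReflTransGen A u v := by
  obtain ⟨f, ⟨-, hs⟩, rfl, rfl⟩ := h
  induction n with
  | zero => exact .refl
  | succ n ih => exact (ih fun i hi => hs i (by omega)).tail (hs n (by omega))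

theorem PathIn.hasDipath {A : V → V → Prop} {T : Set V} {n : ℕ} {u v : V}
    (h : PathIn A T n u v) : HasDipath A n u v := by
  obtain ⟨f, hf, h0, hn, -⟩ := h
  exact ⟨f, hf, h0, hn⟩

theorem IsDipathOn.pathIn_segment {A : V → V → Prop} {n : ℕ} {x : ℕ → V}
    (h : IsDipathOn A n x) {i j : ℕ} (hij : i ≤ j) (hj : j ≤ n) :
    PathIn A {w | ∃ t, i ≤ t ∧ t ≤ j ∧ x t = w} (j - i) (x i) (x j) := by
  refine ⟨fun t => x (i + t), ⟨fun s t hs ht hst => ?_, fun t ht => h.2 (i + t) (by omega)⟩, rfl,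
    by simp [Nat.add_sub_cancel' hij], fun t ht => ⟨i + t, by omega, by omega, rfl⟩⟩
  have := h.1 _ _ (by omega) (by omega) hst
  omega

theorem IsDipathOn.disjoint_segments {A : V → V → Prop} {n : ℕ} {x : ℕ → V}
    (h : IsDipathOn A n x) {i j : ℕ} (hij : i < j) (hi : i ≤ n) :
    Disjoint {w | ∃ t, 0 ≤ t ∧ t ≤ i ∧ x t = w} {w | ∃ t, j ≤ t ∧ t ≤ n ∧ x t = w} := by
  refine Set.disjoint_left.2 ?_
  rintro _ ⟨s, -, hs, rfl⟩ ⟨t, ht, htn, hst⟩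
  have := h.1 _ _ htn (by omega) hst
  omega

theorem stmt_13
    {V : Type*} [Fintype V] (A : V → V → Prop) (hirr : Irreflexive A)
    (k : ℕ) (hk5 : 5 ≤ k) (hkodd : Odd k)
    (hQT : KQuasiTransitive A k) (hstrong : StrongD A)
    (u v : V) (hdist : ∀ m, m < k + 2 → ¬ HasDipath A m u v)
    (P : ℕ → V) (hP : IsDipathOn A (k + 2) P) (hPu : P 0 = u) (hPv : P (k + 2) = v)
    (hsemi : SemicompleteOn A (VertsUpTo (k + 2) P)) :
    SemicompleteOn A {w | w ∉ VertsUpTo (k + 2) P} := by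
  subst hPu hPv
  have hforward : ∀ i j, i + 2 ≤ j → j ≤ k + 2 → ¬ A (P i) (P j) := by
    intro i j hij hj harc
    refine hdist _ ?_ ((hP.pathIn_segment (Nat.zero_le i) (by omega)).append harc
      (hP.pathIn_segment hj le_rfl) (hP.disjoint_segments (by omega) (by omega))).hasDipath
    omega
  have hbackward : BackwardPath A k P :=
    { five_le := hk5
      quasi := hQT
      strong := fun a b => (hstrong a b).choose_spec.reflTransGen
      path := hP
      back := by
        intro i j hij hj
        refine (hsemi (P i) ⟨i, by omega, rfl⟩ (P j) ⟨j, hj, rfl⟩ fun heq => ?_).resolve_left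
          (hforward i j hij hj)
        have := hP.1 i j (by omega) hj heq
        omega
      shortcut := by
        intro i j w hi hj hw hiw hwj
        by_contra hlt
        refine hdist _ ?_ (((hP.pathIn_segment (Nat.zero_le i) hi).concat hiw ?_).append hwj
          (hP.pathIn_segment hj le_rfl) ?_).hasDipath
        · omega
        · rintro ⟨t, -, ht, rfl⟩
          exact hw ⟨t, by omega, rfl⟩
        · refine Set.disjoint_union_left.2 ⟨hP.disjoint_segments (by omega) (by omega), ?_⟩
          rw [Set.disjoint_singleton_left]
          rintro ⟨t, -, ht, rfl⟩
          exact hw ⟨t, ht, rfl⟩ }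
  exact hbackward.semicompleteOn_compl
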